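/- arXiv:2302.09946 — 2 statements merged into one kernel-verified Lean document; each statement's English description precedes it below -/
import Mathlib

section
/- Let h : ℝ × ℝ^d → ℝ be continuously differentiable with bounded partial derivatives. Then the Stein solution f_h satisfies ‖∂_x f_h‖_∞ ≤ (1/σ)·√(2/π)·‖∂_x h‖_∞. -/
open MeasureTheory ProbabilityTheory

/-- The Stein solution `f_h` associated to `h : ℝ × ℝ^d → ℝ`:
`f_h(x,y) = −(1/σ²) ∫₀¹ (2√(t(1−t)))⁻¹ ⬝ E[Z ⬝ h(√t x + √(1−t) Z, y)] dt`
where `Z ~ N(0, σ²)`. -/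
noncomputable def steinSol {d : ℕ} (σ : ℝ)
    (h : ℝ × EuclideanSpace ℝ (Fin d) → ℝ)
    (x : ℝ) (y : EuclideanSpace ℝ (Fin d)) : ℝ :=
  -(1 / σ ^ 2) * ∫ t in (0:ℝ)..1, (2 * Real.sqrt (t * (1 - t)))⁻¹ *
    ∫ z, z * h (Real.sqrt t * x + Real.sqrt (1 - t) * z, y)
      ∂(gaussianReal 0 ⟨σ ^ 2, sq_nonneg σ⟩)

/-- Difference of two integrals, controlled by a dominating function of the difference. -/
lemma abs_integral_sub_le {α : Type*} [MeasurableSpace α] {μ : Measure α} {f g B : α → ℝ}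
    (hf : AEStronglyMeasurable f μ) (hg : AEStronglyMeasurable g μ) (hB : Integrable B μ)
    (hle : ∀ᵐ a ∂μ, |f a - g a| ≤ B a) :
    |∫ a, f a ∂μ - ∫ a, g a ∂μ| ≤ ∫ a, B a ∂μ := by
  have hD : Integrable (fun a => f a - g a) μ := hB.mono' (hf.sub hg) hle
  have key : ∫ a, f a ∂μ - ∫ a, g a ∂μ = ∫ a, (f a - g a) ∂μ ∨
      ∫ a, f a ∂μ - ∫ a, g a ∂μ = 0 := by
    by_cases hfi : Integrable f μ
    · left
      have hgi : Integrable g μ := by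
        have := hfi.sub hD
        refine this.congr (Filter.Eventually.of_forall fun a => ?_)
        simp
      rw [integral_sub hfi hgi]
    · right
      have hgi : ¬ Integrable g μ := by
        intro hgi
        apply hfi
        have := hgi.add hD
        refine this.congr (Filter.Eventually.of_forall fun a => ?_)
        simp
      rw [integral_undef hfi, integral_undef hgi, sub_zero]
  rcases key with h | h
  · rw [h]
    exact norm_integral_le_of_norm_le (f := fun a => f a - g a) hB hle
  · rw [h, abs_zero]
    apply integral_nonneg_of_ae
    filter_upwards [hle] with a ha
    exact (abs_nonneg _).trans ha

lemma integral_abs_gaussian (σ : ℝ) (hσ : 0 < σ) :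
    ∫ z, |z| ∂(gaussianReal 0 ⟨σ ^ 2, sq_nonneg σ⟩) = σ * Real.sqrt (2 / Real.pi) := by
  have hv : (⟨σ ^ 2, sq_nonneg σ⟩ : NNReal) ≠ 0 := by
    intro h
    have h2 : σ ^ 2 = 0 := congrArg NNReal.toReal h
    exact (pow_pos hσ 2).ne' h2
  rw [integral_gaussianReal_eq_integral_smul hv]
  have e : ∀ x : ℝ, gaussianPDFReal 0 ⟨σ ^ 2, sq_nonneg σ⟩ x • |x| =
      (fun u : ℝ => (Real.sqrt (2 * Real.pi * σ ^ 2))⁻¹ *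
        (u ^ (1:ℝ) * Real.exp (-(1 / (2 * σ ^ 2)) * u ^ (2:ℝ)))) |x| := by
    intro x
    change (Real.sqrt (2 * Real.pi * σ ^ 2))⁻¹ * Real.exp (-(x - 0) ^ 2 / (2 * σ ^ 2)) * |x| = _
    simp only [sub_zero, Real.rpow_one, Real.rpow_two, sq_abs]
    rw [mul_assoc, mul_comm |x|]
    congr 3
    ring
  rw [integral_congr_ae (Filter.Eventually.of_forall e), integral_comp_abs
    (f := fun u : ℝ => (Real.sqrt (2 * Real.pi * σ ^ 2))⁻¹ *
        (u ^ (1:ℝ) * Real.exp (-(1 / (2 * σ ^ 2)) * u ^ (2:ℝ)))), MeasureTheory.integral_const_mul,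
    integral_rpow_mul_exp_neg_mul_rpow (by norm_num) (by norm_num) (by positivity)]
  norm_num
  rw [Real.sqrt_mul (by positivity), Real.sqrt_mul (by norm_num), Real.sqrt_sq hσ.le, Real.rpow_neg_one]
  have hp := Real.sqrt_pos.2 Real.pi_pos
  have h2 : √(2:ℝ) ^ 2 = 2 := Real.sq_sqrt (by norm_num)
  field_simp
  try linarith

lemma weight_integrable :
    IntervalIntegrable (fun t : ℝ => (2 * Real.sqrt (1 - t))⁻¹) volume 0 1 := by
  have h1 : IntervalIntegrable (fun x : ℝ => x ^ (-(1/2) : ℝ)) volume 0 1 :=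
    intervalIntegral.intervalIntegrable_rpow' (by norm_num)
  have h2 := ((h1.comp_sub_left 1).symm).const_mul (2⁻¹)
  norm_num at h2
  refine h2.congr ?_
  intro t ht
  rw [Set.uIoc_of_le zero_le_one] at ht
  simp only []
  rw [mul_inv, Real.sqrt_eq_rpow, ← Real.rpow_neg (by linarith [ht.2])]
  norm_num

lemma weight_integral :
    ∫ t in (0:ℝ)..1, (2 * Real.sqrt (1 - t))⁻¹ = 1 := by
  have h := intervalIntegral.integral_comp_sub_left (a := 0) (b := 1)
    (fun x : ℝ => (2 * Real.sqrt x)⁻¹) 1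
  rw [h]
  have : ∫ x in (1 - 1 : ℝ)..(1 - 0), (2 * Real.sqrt x)⁻¹ =
      ∫ x in (0:ℝ)..1, 2⁻¹ * x ^ (-(1/2) : ℝ) := by
    norm_num only
    apply intervalIntegral.integral_congr
    intro t ht
    rw [Set.uIcc_of_le zero_le_one] at ht
    simp only []
    rw [mul_inv, Real.sqrt_eq_rpow, ← Real.rpow_neg ht.1]
    norm_num
  rw [this, intervalIntegral.integral_const_mul, integral_rpow (by left; norm_num)]
  norm_num

/-- The Stein solution satisfies `‖∂_x f_h‖_∞ ≤ (1/σ)·√(2/π)·‖∂_x h‖_∞`. -/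
theorem stmt6 {d : ℕ} (hd : 1 ≤ d) (σ : ℝ) (hσ : 0 < σ)
    (h : ℝ × EuclideanSpace ℝ (Fin d) → ℝ)
    (hh : ContDiff ℝ 1 h)
    (hhB : ∃ C : ℝ, ∀ p, ‖fderiv ℝ h p‖ ≤ C) :
    ∀ C : ℝ, (∀ (x : ℝ) (y : EuclideanSpace ℝ (Fin d)),
        |deriv (fun t => h (t, y)) x| ≤ C) →
      ∀ (x : ℝ) (y : EuclideanSpace ℝ (Fin d)),
        |deriv (fun t => steinSol σ h t y) x| ≤ (1 / σ) * Real.sqrt (2 / Real.pi) * C := by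
  intro C hC x y
  have hC0 : 0 ≤ C := (abs_nonneg _).trans (hC 0 y)
  have hcont : Continuous h := hh.continuous
  have hdiff : Differentiable ℝ (fun t => h (t, y)) := by
    have := hh.differentiable one_ne_zero
    fun_prop
  have hlip : ∀ a b : ℝ, |h (a, y) - h (b, y)| ≤ C * |a - b| := fun a b =>
    Convex.norm_image_sub_le_of_norm_deriv_le (f := fun t => h (t, y)) (s := Set.univ)
      (fun x _ => hdiff x) (fun x _ => hC x y) convex_univ (Set.mem_univ b) (Set.mem_univ a)
  have hZ : Integrable (fun z : ℝ => |z|) (gaussianReal 0 ⟨σ ^ 2, sq_nonneg σ⟩) := by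
    have := (memLp_id_gaussianReal (μ := 0) (v := ⟨σ ^ 2, sq_nonneg σ⟩) 1)
    exact (memLp_one_iff_integrable.1 (by exact_mod_cast this)).abs
  rw [← Real.norm_eq_abs]
  refine norm_deriv_le_of_lip' (by positivity) (Filter.Eventually.of_forall fun x' => ?_)
  simp only [steinSol, Real.norm_eq_abs]
  rw [← mul_sub, abs_mul]
  have inner : ∀ t : ℝ, 
      |(∫ z, z * h (Real.sqrt t * x' + Real.sqrt (1 - t) * z, y)
          ∂(gaussianReal 0 ⟨σ ^ 2, sq_nonneg σ⟩)) -
        ∫ z, z * h (Real.sqrt t * x + Real.sqrt (1 - t) * z, y)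
          ∂(gaussianReal 0 ⟨σ ^ 2, sq_nonneg σ⟩)| ≤
      C * (Real.sqrt t * |x' - x|) * (σ * Real.sqrt (2 / Real.pi)) := by
    intro t
    rw [← integral_abs_gaussian σ hσ, ← MeasureTheory.integral_const_mul]
    apply abs_integral_sub_le
    · exact Continuous.aestronglyMeasurable (by fun_prop)
    · exact Continuous.aestronglyMeasurable (by fun_prop)
    · exact hZ.const_mul _
    · refine Filter.Eventually.of_forall fun z => ?_
      rw [← mul_sub, abs_mul, mul_comm]
      gcongr
      refine (hlip _ _).trans (le_of_eq ?_)
      rw [add_sub_add_right_eq_sub, ← mul_sub, abs_mul, abs_of_nonneg (Real.sqrt_nonneg t)]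
  have meas : ∀ x : ℝ, StronglyMeasurable (fun t : ℝ => (2 * Real.sqrt (t * (1 - t)))⁻¹ *
      ∫ z, z * h (Real.sqrt t * x + Real.sqrt (1 - t) * z, y)
        ∂(gaussianReal 0 ⟨σ ^ 2, sq_nonneg σ⟩)) := by
    intro x
    haveI : IsProbabilityMeasure (gaussianReal 0 ⟨σ ^ 2, sq_nonneg σ⟩) :=
      instIsProbabilityMeasureGaussianReal _ _
    apply StronglyMeasurable.mul
    · exact Measurable.stronglyMeasurable (by fun_prop)
    · exact StronglyMeasurable.integral_prod_right'
        (f := fun p : ℝ × ℝ => p.2 * h (Real.sqrt p.1 * x + Real.sqrt (1 - p.1) * p.2, y))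
        (Continuous.stronglyMeasurable (by fun_prop))
  have outer : |(∫ t in (0:ℝ)..1, (2 * Real.sqrt (t * (1 - t)))⁻¹ *
      ∫ z, z * h (Real.sqrt t * x' + Real.sqrt (1 - t) * z, y)
        ∂(gaussianReal 0 ⟨σ ^ 2, sq_nonneg σ⟩)) -
      ∫ t in (0:ℝ)..1, (2 * Real.sqrt (t * (1 - t)))⁻¹ *
      ∫ z, z * h (Real.sqrt t * x + Real.sqrt (1 - t) * z, y)
        ∂(gaussianReal 0 ⟨σ ^ 2, sq_nonneg σ⟩)| ≤
      C * |x' - x| * (σ * Real.sqrt (2 / Real.pi)) := by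
    have hw := weight_integral
    have hwi := weight_integrable
    rw [intervalIntegral.integral_of_le zero_le_one] at hw ⊢
    rw [intervalIntegral.integral_of_le zero_le_one]
    rw [intervalIntegrable_iff_integrableOn_Ioc_of_le zero_le_one] at hwi
    have hval : C * |x' - x| * (σ * Real.sqrt (2 / Real.pi)) =
        ∫ t in Set.Ioc (0:ℝ) 1, (C * |x' - x| * (σ * Real.sqrt (2 / Real.pi))) *
          (2 * Real.sqrt (1 - t))⁻¹ := by
      rw [MeasureTheory.integral_const_mul, hw, mul_one]
    rw [hval]
    apply abs_integral_sub_le (meas x').aestronglyMeasurable (meas x).aestronglyMeasurable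
      (hwi.const_mul _)
    filter_upwards [ae_restrict_mem measurableSet_Ioc] with t ht
    rw [← mul_sub, abs_mul, abs_of_nonneg (by positivity)]
    refine (mul_le_mul_of_nonneg_left (inner t) (by positivity)).trans (le_of_eq ?_)
    have hst : Real.sqrt t ≠ 0 := (Real.sqrt_pos.2 ht.1).ne'
    rw [Real.sqrt_mul ht.1.le, mul_inv, mul_inv, mul_inv]
    have : (Real.sqrt t)⁻¹ * Real.sqrt t = 1 := inv_mul_cancel₀ hst
    linear_combination (2⁻¹ * (Real.sqrt (1 - t))⁻¹ * C * |x' - x| * σ *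
      Real.sqrt (2 / Real.pi)) * this
  refine (mul_le_mul_of_nonneg_left outer (abs_nonneg _)).trans (le_of_eq ?_)
  rw [abs_neg, abs_of_pos (by positivity)]
  field_simp
end

section
/- Let h : ℝ × ℝ^d → ℝ be continuously differentiable with bounded partial derivatives. Then for every j = 1,…,d the Stein solution f_h satisfies ‖∂_{y_j} f_h‖_∞ ≤ (1/σ)·√(π/2)·‖∂_{y_j} h‖_∞, where ∂_{y_j} denotes the partial derivative with respect to the j-th coordinate of the ℝ^d-variable. -/
open MeasureTheory ProbabilityTheory

lemma int_abs_aux (v : NNReal) : Integrable (fun z : ℝ => |z|) (gaussianReal 0 v) := by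
  have h1 : Integrable (fun z : ℝ => z) (gaussianReal 0 v) :=
    memLp_one_iff_integrable.1 (memLp_id_gaussianReal' 1 (by simp))
  exact h1.abs

/-- The first absolute moment of a centered Gaussian. -/
lemma abs_moment_aux (σ : ℝ) (hσ : 0 < σ) (v : NNReal) (hvσ : (v : ℝ) = σ ^ 2) :
    ∫ z, |z| ∂(gaussianReal 0 v) = σ * Real.sqrt (2 / Real.pi) := by
  have hv : v ≠ 0 := by
    rintro rfl
    exact (pow_pos hσ 2).ne' (by simpa using hvσ.symm)
  rw [integral_gaussianReal_eq_integral_smul hv]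
  have key := integral_rpow_mul_exp_neg_mul_rpow (p := 2) (q := 1) (b := (2 * σ ^ 2)⁻¹)
    (by norm_num) (by norm_num) (by positivity)
  have e : ∀ x : ℝ, gaussianPDFReal 0 v x • |x|
      = (fun u : ℝ => (Real.sqrt (2 * Real.pi * σ ^ 2))⁻¹ *
        (u ^ (1:ℝ) * Real.exp (-(2 * σ ^ 2)⁻¹ * u ^ (2:ℝ)))) |x| := by
    intro x
    simp only [gaussianPDFReal, smul_eq_mul, Real.rpow_one, Real.rpow_two, sq_abs, sub_zero]
    rw [hvσ]
    have : -x ^ 2 / (2 * σ ^ 2) = -(2 * σ ^ 2)⁻¹ * x ^ 2 := by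
      field_simp
    rw [this]
    ring
  rw [integral_congr_ae (Filter.Eventually.of_forall e), integral_comp_abs (f := fun u : ℝ =>
    (Real.sqrt (2 * Real.pi * σ ^ 2))⁻¹ *
      (u ^ (1:ℝ) * Real.exp (-(2 * σ ^ 2)⁻¹ * u ^ (2:ℝ)))), integral_const_mul, key]
  have e1 : (-(1 + 1) / 2 : ℝ) = -1 := by norm_num
  have e2 : ((1 + 1) / 2 : ℝ) = 1 := by norm_num
  rw [e1, e2, Real.Gamma_one, Real.rpow_neg_one, inv_inv,
    Real.sqrt_mul' _ (sq_nonneg σ), Real.sqrt_sq hσ.le, Real.sqrt_mul (by norm_num),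
    Real.sqrt_div (by norm_num)]
  have h2 : Real.sqrt 2 ^ 2 = 2 := Real.sq_sqrt (by norm_num)
  have : 0 < Real.sqrt 2 := by positivity
  have : 0 < Real.sqrt Real.pi := Real.sqrt_pos.2 Real.pi_pos
  field_simp
  linarith

lemma weight_aux : IntervalIntegrable (fun t : ℝ => (2 * Real.sqrt (t * (1 - t)))⁻¹) volume 0 1 ∧
    ∫ t in (0:ℝ)..1, (2 * Real.sqrt (t * (1 - t)))⁻¹ = Real.pi / 2 := by
  have hc : Continuous (fun t : ℝ => Real.arcsin (Real.sqrt t)) :=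
    Real.continuous_arcsin.comp Real.continuous_sqrt
  have hd : ∀ t ∈ Set.Ioo (0:ℝ) 1, HasDerivAt (fun t : ℝ => Real.arcsin (Real.sqrt t))
      ((2 * Real.sqrt (t * (1 - t)))⁻¹) t := by
    intro t ht
    have h0 : 0 < Real.sqrt t := Real.sqrt_pos.2 ht.1
    have h1 : Real.sqrt t < 1 := by
      rw [Real.sqrt_lt' one_pos]; simpa using ht.2
    have := (Real.hasDerivAt_arcsin (x := Real.sqrt t) (by linarith) h1.ne).comp t
      (Real.hasDerivAt_sqrt ht.1.ne')
    refine HasDerivAt.congr_deriv (f := fun t : ℝ => Real.arcsin (Real.sqrt t)) this ?_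
    rw [Real.sq_sqrt ht.1.le, Real.sqrt_mul ht.1.le]
    have : 0 < Real.sqrt (1 - t) := Real.sqrt_pos.2 (by linarith [ht.2])
    field_simp
  have hi : IntervalIntegrable (fun t : ℝ => (2 * Real.sqrt (t * (1 - t)))⁻¹) volume 0 1 := by
    apply intervalIntegral.intervalIntegrable_deriv_of_nonneg hc.continuousOn
    · simpa using hd
    · intro t _
      positivity
  refine ⟨hi, ?_⟩
  rw [intervalIntegral.integral_eq_sub_of_hasDerivAt_of_le zero_le_one hc.continuousOn hd hi]
  simp

/-- Integrability facts for the integrand at a fixed `y`. -/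
lemma inner_aux (v : NNReal) (g : ℝ → ℝ) (K : ℝ) (hg : Continuous g)
    (hK : ∀ u, |g u| ≤ |g 0| + K * |u|) (x : ℝ) :
    (∀ t ∈ Set.Icc (0:ℝ) 1, Integrable (fun z => z * g (Real.sqrt t * x + Real.sqrt (1 - t) * z))
      (gaussianReal 0 v)) ∧
    IntervalIntegrable (fun t : ℝ => (2 * Real.sqrt (t * (1 - t)))⁻¹ *
      ∫ z, z * g (Real.sqrt t * x + Real.sqrt (1 - t) * z)
        ∂(gaussianReal 0 v)) volume 0 1 := by
  set γ := gaussianReal 0 v with hγ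
  have : IsProbabilityMeasure γ := by rw [hγ]; infer_instance
  have hK0 : 0 ≤ K := by
    have h1 := hK 1
    have h2 := hK 0
    by_contra hn
    push Not at hn
    have h3 := hK ((|g 0| + 1) / (-K))
    have h4 : K * |(|g 0| + 1) / (-K)| = -(|g 0| + 1) := by
      have : 0 < -K := by linarith
      rw [abs_of_nonneg (by positivity)]
      have hne : K ≠ 0 := hn.ne
      field_simp
    have := abs_nonneg (g ((|g 0| + 1) / (-K)))
    linarith
  have i1 : Integrable (fun z : ℝ => |z|) γ := int_abs_aux v
  have i2 : Integrable (fun z : ℝ => z ^ 2) γ :=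
    MemLp.integrable_sq (memLp_id_gaussianReal' 2 (by simp))
  have iB : Integrable (fun z : ℝ => (|g 0| + K * |x|) * |z| + K * z ^ 2) γ :=
    (i1.const_mul _).add (i2.const_mul _)
  have hb : ∀ t ∈ Set.Icc (0:ℝ) 1, ∀ z, ‖z * g (Real.sqrt t * x + Real.sqrt (1 - t) * z)‖
      ≤ (|g 0| + K * |x|) * |z| + K * z ^ 2 := by
    intro t ht z
    rw [Real.norm_eq_abs, abs_mul]
    have a1 : Real.sqrt t ≤ 1 := Real.sqrt_le_one.2 ht.2
    have a2 : Real.sqrt (1 - t) ≤ 1 := Real.sqrt_le_one.2 (by linarith [ht.1])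
    have a3 : |Real.sqrt t * x + Real.sqrt (1 - t) * z| ≤ |x| + |z| := by
      refine (abs_add_le _ _).trans ?_
      rw [abs_mul, abs_mul, abs_of_nonneg (Real.sqrt_nonneg _), abs_of_nonneg (Real.sqrt_nonneg _)]
      exact add_le_add (mul_le_of_le_one_left (abs_nonneg _) a1)
        (mul_le_of_le_one_left (abs_nonneg _) a2)
    calc |z| * |g (Real.sqrt t * x + Real.sqrt (1 - t) * z)|
        ≤ |z| * (|g 0| + K * (|x| + |z|)) := by
          gcongr
          exact (hK _).trans (by gcongr)
      _ = _ := by rw [← sq_abs z]; ring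
  refine ⟨?_, ?_⟩
  · intro t ht
    exact iB.mono' (by fun_prop) (Filter.Eventually.of_forall (hb t ht))
  · have hm : StronglyMeasurable (fun t : ℝ =>
        ∫ z, z * g (Real.sqrt t * x + Real.sqrt (1 - t) * z) ∂γ) := by
      apply StronglyMeasurable.integral_prod_right
      apply Continuous.stronglyMeasurable
      unfold Function.uncurry
      fun_prop
    rw [intervalIntegrable_iff_integrableOn_Ioc_of_le zero_le_one]
    have hw := (intervalIntegrable_iff_integrableOn_Ioc_of_le zero_le_one).1 weight_aux.1
    refine Integrable.mul_bdd (c := ∫ z, ((|g 0| + K * |x|) * |z| + K * z ^ 2) ∂γ) hw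
      hm.aestronglyMeasurable ?_
    filter_upwards [ae_restrict_mem measurableSet_Ioc] with t ht
    exact norm_integral_le_of_norm_le iB (Filter.Eventually.of_forall (hb t ⟨ht.1.le, ht.2⟩))

/-- For every coordinate `j` of the `ℝ^d`-variable, the Stein solution
satisfies `‖∂_{y_j} f_h‖_∞ ≤ (1/σ)·√(π/2)·‖∂_{y_j} h‖_∞`. The partial derivative in the
`j`-th coordinate of `y` is realized as the derivative at `0` of `s ↦ f(x, y + s • e_j)`. -/
theorem stmt7 {d : ℕ} (hd : 1 ≤ d) (σ : ℝ) (hσ : 0 < σ)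
    (h : ℝ × EuclideanSpace ℝ (Fin d) → ℝ)
    (hh : ContDiff ℝ 1 h)
    (hhB : ∃ C : ℝ, ∀ p, ‖fderiv ℝ h p‖ ≤ C) :
    ∀ j : Fin d, ∀ C : ℝ,
      (∀ (x : ℝ) (y : EuclideanSpace ℝ (Fin d)),
        |deriv (fun s : ℝ => h (x, y + s • EuclideanSpace.single j (1:ℝ))) 0| ≤ C) →
      ∀ (x : ℝ) (y : EuclideanSpace ℝ (Fin d)),
        |deriv (fun s : ℝ => steinSol σ h x (y + s • EuclideanSpace.single j (1:ℝ))) 0|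
          ≤ (1 / σ) * Real.sqrt (Real.pi / 2) * C := by
  intro j C hC x y
  obtain ⟨K, hK⟩ := hhB
  have hC0 : 0 ≤ C := (abs_nonneg _).trans (hC 0 0)
  have hdiff : Differentiable ℝ h := hh.differentiable (by norm_num)
  have hlip : ∀ v u, |h (u, v)| ≤ |h (0, v)| + K * |u| := by
    intro v u
    have := Convex.norm_image_sub_le_of_norm_fderiv_le (𝕜 := ℝ) (f := h) (s := Set.univ)
      (x := (0, v)) (y := (u, v)) (C := K) (fun p _ => hdiff p) (fun p _ => hK p)
      convex_univ trivial trivial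
    have e : ‖((u, v) : ℝ × EuclideanSpace ℝ (Fin d)) - (0, v)‖ = |u| := by
      simp [Prod.norm_def]
    rw [e, Real.norm_eq_abs] at this
    have h2 := abs_sub_abs_le_abs_sub (h (u, v)) (h (0, v))
    linarith
  have hylip : ∀ u s, |h (u, y + s • EuclideanSpace.single j (1:ℝ)) - h (u, y)| ≤ C * |s| := by
    intro u s
    have hd1 : Differentiable ℝ (fun s : ℝ => h (u, y + s • EuclideanSpace.single j (1:ℝ))) := by
      fun_prop
    have := Convex.norm_image_sub_le_of_norm_deriv_le (𝕜 := ℝ)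
      (f := fun s : ℝ => h (u, y + s • EuclideanSpace.single j (1:ℝ))) (s := Set.univ)
      (x := 0) (y := s) (C := C) (fun p _ => hd1 p) (fun p _ => by
        have h1 := hC u (y + p • EuclideanSpace.single j (1:ℝ))
        have e : (fun s : ℝ => h (u, y + p • EuclideanSpace.single j (1:ℝ)
              + s • EuclideanSpace.single j (1:ℝ)))
            = fun s : ℝ => (fun s : ℝ => h (u, y + s • EuclideanSpace.single j (1:ℝ))) (p + s) := by
          funext s
          simp only [add_smul, add_assoc]
        rw [e, deriv_comp_const_add (f := fun s : ℝ => h (u, y + s • EuclideanSpace.single j (1:ℝ))),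
          add_zero] at h1
        exact h1)
      convex_univ trivial trivial
    simpa using this
  have hcont : Continuous h := hh.continuous
  have hcr : ∀ v, Continuous (fun u : ℝ => h (u, v)) := fun v => by fun_prop
  have hin := fun v => inner_aux ⟨σ ^ 2, sq_nonneg σ⟩ (fun u => h (u, v)) K (hcr v) (hlip v) x
  rw [← Real.norm_eq_abs]
  refine norm_deriv_le_of_lip' (by positivity) (Filter.Eventually.of_forall fun s => ?_)
  simp only [zero_smul, add_zero, sub_zero, steinSol]
  set v := y + s • EuclideanSpace.single j (1:ℝ) with hvdef
  rw [← mul_sub, ← intervalIntegral.integral_sub (hin v).2 (hin y).2, norm_mul]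
  have i1 : Integrable (fun z : ℝ => |z|) (gaussianReal 0 ⟨σ ^ 2, sq_nonneg σ⟩) :=
    int_abs_aux _
  have hbd := intervalIntegral.norm_integral_le_of_norm_le (μ := volume) (zero_le_one (α := ℝ))
    (f := fun t : ℝ => (2 * Real.sqrt (t * (1 - t)))⁻¹ *
        (∫ z, z * h (Real.sqrt t * x + Real.sqrt (1 - t) * z, v)
          ∂(gaussianReal 0 ⟨σ ^ 2, sq_nonneg σ⟩)) - (2 * Real.sqrt (t * (1 - t)))⁻¹ *
        ∫ z, z * h (Real.sqrt t * x + Real.sqrt (1 - t) * z, y)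
          ∂(gaussianReal 0 ⟨σ ^ 2, sq_nonneg σ⟩))
    (g := fun t : ℝ => (2 * Real.sqrt (t * (1 - t)))⁻¹ *
      (σ * Real.sqrt (2 / Real.pi) * (C * |s|)))
    (Filter.Eventually.of_forall fun t ht => by
      have ht' : t ∈ Set.Icc (0:ℝ) 1 := ⟨ht.1.le, ht.2⟩
      rw [← mul_sub, ← integral_sub ((hin v).1 t ht') ((hin y).1 t ht'), norm_mul,
        Real.norm_of_nonneg (r := (2 * Real.sqrt (t * (1 - t)))⁻¹) (by positivity)]
      refine mul_le_mul_of_nonneg_left ?_ (by positivity)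
      rw [← abs_moment_aux σ hσ ⟨σ ^ 2, sq_nonneg σ⟩ rfl, ← integral_mul_const]
      refine norm_integral_le_of_norm_le (i1.mul_const _) (Filter.Eventually.of_forall fun z => ?_)
      rw [← mul_sub, norm_mul]
      exact mul_le_mul_of_nonneg_left (hylip _ s) (abs_nonneg _))
    (weight_aux.1.mul_const _)
  rw [intervalIntegral.integral_mul_const, weight_aux.2] at hbd
  refine (mul_le_mul_of_nonneg_left hbd (norm_nonneg _)).trans (le_of_eq ?_)
  rw [norm_neg, Real.norm_of_nonneg (by positivity), Real.norm_eq_abs,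
    Real.sqrt_div (by norm_num), Real.sqrt_div Real.pi_pos.le]
  have h2 : Real.sqrt 2 ^ 2 = 2 := Real.sq_sqrt (by norm_num)
  have h3 : Real.sqrt Real.pi ^ 2 = Real.pi := Real.sq_sqrt Real.pi_pos.le
  have : 0 < Real.sqrt 2 := by positivity
  have : 0 < Real.sqrt Real.pi := Real.sqrt_pos.2 Real.pi_pos
  field_simp
  rw [h2, h3]
  ring
end
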